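/- Suppose G : [0,∞) → [0,∞) is continuous, bounded and strictly positive definite. If μ* ∈ Ξ(x) and there exists a constant λ ∈ ℝ such that ∫₀ᵗ h(s) ds + ∫_{[0,T]} G(|t-s|) dμ*(s) - 2φ ∫₀ᵗ X^{μ*}_s ds = λ for all t ∈ [0,T], then μ* minimizes the cost functional: C(μ*) ≤ C(μ) for every μ ∈ Ξ(x). -/

import Mathlib

open MeasureTheory

/-- Integral of a real function against a finite signed Borel measure,
via its Jordan decomposition. -/
noncomputable def sint (ν : SignedMeasure ℝ) (f : ℝ → ℝ) : ℝ :=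
  (∫ t, f t ∂ν.toJordanDecomposition.posPart) -
    ∫ t, f t ∂ν.toJordanDecomposition.negPart

/-- The set Ξ(x) of deterministic admissible strategies: finite signed Borel
measures supported in `[0,T]` with total mass `-x`. -/
def Xi (T x : ℝ) : Set (SignedMeasure ℝ) :=
  {μ | (∀ s : Set ℝ, s ∩ Set.Icc 0 T = ∅ → μ s = 0) ∧ μ Set.univ = -x}

/-- Bounded measurable functions. -/
def BM {α : Type*} [MeasurableSpace α] (f : α → ℝ) : Prop :=
  Measurable f ∧ ∃ M : ℝ, ∀ x, |f x| ≤ M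

lemma BM.integrable {α : Type*} [MeasurableSpace α] {f : α → ℝ} (hf : BM f) (μ : Measure α)
    [IsFiniteMeasure μ] : Integrable f μ := by
  obtain ⟨hm, M, hM⟩ := hf
  exact Integrable.of_bound hm.aestronglyMeasurable M (Filter.Eventually.of_forall hM)

lemma BM.add {α : Type*} [MeasurableSpace α] {f g : α → ℝ} (hf : BM f) (hg : BM g) :
    BM (fun x => f x + g x) := by
  obtain ⟨hm, M, hM⟩ := hf
  obtain ⟨hm', M', hM'⟩ := hg
  exact ⟨hm.add hm', M + M', fun x => (abs_add_le _ _).trans (add_le_add (hM x) (hM' x))⟩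

lemma BM.mul {α : Type*} [MeasurableSpace α] {f g : α → ℝ} (hf : BM f) (hg : BM g) :
    BM (fun x => f x * g x) := by
  obtain ⟨hm, M, hM⟩ := hf
  obtain ⟨hm', M', hM'⟩ := hg
  refine ⟨hm.mul hm', M * M', fun x => ?_⟩
  rw [abs_mul]
  exact mul_le_mul (hM x) (hM' x) (abs_nonneg _) ((abs_nonneg _).trans (hM x))

lemma BM.const {α : Type*} [MeasurableSpace α] (c : ℝ) : BM (fun _ : α => c) :=
  ⟨measurable_const, |c|, fun _ => le_rfl⟩

lemma BM.comp {α β : Type*} [MeasurableSpace α] [MeasurableSpace β] {f : α → ℝ} (hf : BM f)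
    {g : β → α} (hg : Measurable g) : BM (fun x => f (g x)) :=
  ⟨hf.1.comp hg, hf.2.imp fun _ h x => h (g x)⟩

lemma BM.intg {F : ℝ × ℝ → ℝ} (hF : BM F) (μ : Measure ℝ) [IsFiniteMeasure μ] :
    BM (fun t => ∫ s, F (t, s) ∂μ) := by
  obtain ⟨hm, M, hM⟩ := hF
  refine ⟨(hm.stronglyMeasurable.integral_prod_right' (ν := μ)).measurable, M * μ.real Set.univ, fun t => ?_⟩
  exact norm_integral_le_of_norm_le_const (μ := μ) (f := fun s => F (t, s)) (C := M)
    (Filter.Eventually.of_forall fun s => hM (t, s))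

lemma BM.sint {F : ℝ × ℝ → ℝ} (hF : BM F) (ν : SignedMeasure ℝ) :
    BM (fun t => sint ν (fun s => F (t, s))) := by
  have h1 := hF.intg ν.toJordanDecomposition.posPart
  have h2 := (BM.const (-1)).mul (hF.intg ν.toJordanDecomposition.negPart)
  convert h1.add h2 using 2
  simp [_root_.sint, sub_eq_add_neg]

lemma sint_fubini {F : ℝ × ℝ → ℝ} (hF : BM F) (ν : SignedMeasure ℝ) (μ : Measure ℝ)
    [IsFiniteMeasure μ] :
    ∫ t, sint ν (fun s => F (t, s)) ∂μ = sint ν (fun s => ∫ t, F (t, s) ∂μ) := by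
  unfold sint
  rw [integral_sub ((hF.intg _).integrable _) ((hF.intg _).integrable _)]
  rw [integral_integral_swap (f := fun t s => F (t, s)) (hF.integrable _),
    integral_integral_swap (f := fun t s => F (t, s)) (hF.integrable _)]

lemma sint_sint_swap {F : ℝ × ℝ → ℝ} (hF : BM F) (ν μ : SignedMeasure ℝ) :
    sint μ (fun t => sint ν (fun s => F (t, s))) = sint ν (fun s => sint μ (fun t => F (t, s))) := by
  have hF' : BM (fun p : ℝ × ℝ => F (p.2, p.1)) := hF.comp measurable_swap
  conv_lhs => unfold sint
  have h1 := sint_fubini hF ν μ.toJordanDecomposition.posPart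
  have h2 := sint_fubini hF ν μ.toJordanDecomposition.negPart
  have e1 := (hF'.intg μ.toJordanDecomposition.posPart)
  have e2 := (hF'.intg μ.toJordanDecomposition.negPart)
  unfold sint at h1 h2 ⊢
  rw [h1, h2, integral_sub (e1.integrable _) (e2.integrable _),
    integral_sub (e1.integrable _) (e2.integrable _)]
  ring

lemma sint_add_fun (ν : SignedMeasure ℝ) {f g : ℝ → ℝ} (hf : BM f) (hg : BM g) :
    sint ν (fun t => f t + g t) = sint ν f + sint ν g := by
  unfold sint
  rw [integral_add (hf.integrable _) (hg.integrable _),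
    integral_add (hf.integrable _) (hg.integrable _)]
  ring

lemma sint_mul_fun (ν : SignedMeasure ℝ) (c : ℝ) (f : ℝ → ℝ) :
    sint ν (fun t => c * f t) = c * sint ν f := by
  unfold sint
  rw [integral_const_mul, integral_const_mul]
  ring

lemma sint_indicator (ν : SignedMeasure ℝ) {s : Set ℝ} (hs : MeasurableSet s) :
    sint ν (s.indicator fun _ => 1) = ν s := by
  unfold sint
  rw [SignedMeasure.apply_eq_posPart_real_sub_negPart_real ν hs]
  have := fun μ : Measure ℝ => integral_indicator_one (μ := μ) hs
  simp only [Pi.one_def] at this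
  rw [this, this]

lemma sint_const (ν : SignedMeasure ℝ) (c : ℝ) :
    sint ν (fun _ => c) = c * ν Set.univ := by
  rw [← sint_indicator ν MeasurableSet.univ, ← sint_mul_fun]
  simp

lemma sint_add (μ ν : SignedMeasure ℝ) {f : ℝ → ℝ} (hf : BM f) :
    sint (μ + ν) f = sint μ f + sint ν f := by
  have key : (μ + ν).toJordanDecomposition.posPart +
      (μ.toJordanDecomposition.negPart + ν.toJordanDecomposition.negPart)
      = (μ + ν).toJordanDecomposition.negPart +
      (μ.toJordanDecomposition.posPart + ν.toJordanDecomposition.posPart) := by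
    rw [← Measure.toSignedMeasure_eq_toSignedMeasure_iff]
    simp only [Measure.toSignedMeasure_add]
    have h1 := SignedMeasure.toSignedMeasure_toJordanDecomposition (μ + ν)
    have h2 := SignedMeasure.toSignedMeasure_toJordanDecomposition μ
    have h3 := SignedMeasure.toSignedMeasure_toJordanDecomposition ν
    unfold JordanDecomposition.toSignedMeasure at h1 h2 h3
    have h4 := h1.trans (congrArg₂ (· + ·) h2 h3).symm
    rw [sub_eq_iff_eq_add] at h4
    rw [h4]
    abel
  have := congrArg (fun m => ∫ t, f t ∂m) key
  rw [integral_add_measure (hf.integrable _) (hf.integrable _),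
    integral_add_measure (hf.integrable _) (hf.integrable _),
    integral_add_measure (hf.integrable _) (hf.integrable _),
    integral_add_measure (hf.integrable _) (hf.integrable _)] at this
  unfold sint
  linarith

lemma sint_congr {T : ℝ} {ν : SignedMeasure ℝ}
    (hν : ∀ s : Set ℝ, s ∩ Set.Icc 0 T = ∅ → ν s = 0) {f g : ℝ → ℝ}
    (hfg : ∀ t ∈ Set.Icc 0 T, f t = g t) : sint ν f = sint ν g := by
  have hm : MeasurableSet (Set.Icc 0 T)ᶜ := measurableSet_Icc.compl
  have hz : ∀ i : Set ℝ, ν (i ∩ (Set.Icc 0 T)ᶜ) = 0 := fun i => hν _ (by ext; simp)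
  obtain ⟨i, hi, hi2, hi3, hp, hn⟩ := ν.toJordanDecomposition_spec
  have h1 : ν.toJordanDecomposition.posPart (Set.Icc 0 T)ᶜ = 0 := by
    rw [hp, SignedMeasure.toMeasureOfZeroLE_apply _ _ _ hm]
    simp only [hz]
    simp
  have h2 : ν.toJordanDecomposition.negPart (Set.Icc 0 T)ᶜ = 0 := by
    rw [hn, SignedMeasure.toMeasureOfLEZero_apply _ _ _ hm]
    simp only [hz]
    simp
  unfold sint
  congr 1
  · apply integral_congr_ae
    filter_upwards [mem_ae_iff.2 h1] with t ht using hfg t ht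
  · apply integral_congr_ae
    filter_upwards [mem_ae_iff.2 h2] with t ht using hfg t ht

lemma bm_clamp {T : ℝ} (hT : 0 < T) {f : ℝ → ℝ} (hf : IntegrableOn f (Set.Icc 0 T)) :
    BM (fun t => ∫ s in (0:ℝ)..(max 0 (min t T)), f s) := by
  have hc : ContinuousOn (fun t => ∫ s in (0:ℝ)..t, f s) (Set.Icc 0 T) := by
    have := intervalIntegral.continuousOn_primitive_interval (a := 0) (b := T) (f := f) (μ := volume)
      (by rwa [Set.uIcc_of_le hT.le])
    rwa [Set.uIcc_of_le hT.le] at this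
  have hmem : ∀ t : ℝ, max 0 (min t T) ∈ Set.Icc 0 T := fun t =>
    ⟨le_max_left _ _, max_le hT.le (min_le_right _ _)⟩
  obtain ⟨M, hM⟩ := isCompact_Icc.exists_bound_of_continuousOn hc
  exact ⟨(hc.comp_continuous (by fun_prop) hmem).measurable, M, fun t => hM _ (hmem t)⟩

lemma clamp_eq {T t : ℝ} (ht : t ∈ Set.Icc 0 T) : max 0 (min t T) = t := by
  rw [min_eq_left ht.2, max_eq_right ht.1]

lemma bm_ico : BM (fun p : ℝ × ℝ => (Set.Ico 0 p.1).indicator (fun _ => (1:ℝ)) p.2) := by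
  have hs : MeasurableSet {p : ℝ × ℝ | 0 ≤ p.2 ∧ p.2 < p.1} :=
    (measurableSet_le measurable_const measurable_snd).inter
      (measurableSet_lt measurable_snd measurable_fst)
  refine ⟨?_, 1, fun p => ?_⟩
  · have : Measurable ({p : ℝ × ℝ | 0 ≤ p.2 ∧ p.2 < p.1}.indicator fun _ => (1:ℝ)) :=
      measurable_const.indicator hs
    exact this
  · by_cases h : p.2 ∈ Set.Ico 0 p.1 <;> simp [Set.indicator, h]

lemma bm_apply (ν : SignedMeasure ℝ) : BM (fun t => ν (Set.Ico 0 t)) := by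
  have := bm_ico.sint ν
  convert this using 2 with t
  exact (sint_indicator ν measurableSet_Ico).symm

lemma inventory_fubini {T : ℝ} (hT : 0 < T) {X : ℝ → ℝ} (hX : BM X) {ν : SignedMeasure ℝ}
    (hν : ∀ s : Set ℝ, s ∩ Set.Icc 0 T = ∅ → ν s = 0) (h0 : ν Set.univ = 0) :
    ∫ t in (0:ℝ)..T, X t * ν (Set.Ico 0 t) =
      - sint ν (fun t => ∫ s in (0:ℝ)..(max 0 (min t T)), X s) := by
  have hXi : ∀ a b, IntervalIntegrable X volume a b := fun a b =>
    ⟨hX.integrable _, hX.integrable _⟩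
  have hF : BM (fun p : ℝ × ℝ => X p.1 * (Set.Ico 0 p.1).indicator (fun _ => (1:ℝ)) p.2) :=
    (hX.comp measurable_fst).mul bm_ico
  have e := sint_fubini hF ν (volume.restrict (Set.Ioc 0 T))
  simp only [sint_mul_fun] at e
  have e2 : ∀ t, sint ν (fun s => (Set.Ico 0 t).indicator (fun _ => (1:ℝ)) s) = ν (Set.Ico 0 t) :=
    fun t => sint_indicator ν measurableSet_Ico
  simp only [e2] at e
  rw [intervalIntegral.integral_of_le hT.le, e]
  have hP := bm_clamp hT (f := X) (hX.integrable _)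
  have : sint ν (fun s => ∫ t in Set.Ioc 0 T, X t * (Set.Ico 0 t).indicator (fun _ => (1:ℝ)) s)
      = sint ν (fun s => (∫ t in (0:ℝ)..T, X t) +
        (-1) * ∫ t in (0:ℝ)..(max 0 (min s T)), X t) := by
    refine sint_congr hν fun s hs => ?_
    rw [clamp_eq hs, ← intervalIntegral.integral_of_le hT.le]
    have hFs : BM (fun t => X t * (Set.Ico 0 t).indicator (fun _ => (1:ℝ)) s) :=
      hF.comp (g := fun t => (t, s)) (by fun_prop)
    rw [← intervalIntegral.integral_add_adjacent_intervals (a := 0) (b := s) (c := T)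
      ⟨hFs.integrable _, hFs.integrable _⟩ ⟨hFs.integrable _, hFs.integrable _⟩,
      ← intervalIntegral.integral_add_adjacent_intervals (hXi 0 s) (hXi s T)]
    have a1 : ∫ t in (0:ℝ)..s, X t * (Set.Ico 0 t).indicator (fun _ => (1:ℝ)) s = 0 := by
      rw [intervalIntegral.integral_of_le hs.1]
      refine setIntegral_eq_zero_of_forall_eq_zero fun t ht => ?_
      simp [Set.indicator, ht.2]
    have a2 : ∫ t in s..T, X t * (Set.Ico 0 t).indicator (fun _ => (1:ℝ)) s = ∫ t in s..T, X t := by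
      rw [intervalIntegral.integral_of_le hs.2, intervalIntegral.integral_of_le hs.2]
      refine setIntegral_congr_fun measurableSet_Ioc fun t ht => ?_
      have h1 := hs.1
      have h2 := ht.1
      simp [Set.indicator, h1, h2]
    rw [a1, a2]
    ring
  rw [this, sint_add_fun ν (BM.const _) ((BM.const _).mul hP), sint_mul_fun, sint_const, h0]
  ring

/-- Sufficiency of the first-order condition: if `μ* ∈ Ξ(x)` satisfies the
optimality equation with some constant Lagrange multiplier `λ`, then `μ*`
minimizes the cost functional over `Ξ(x)`. -/
theorem stmt_2 (T x φ : ℝ) (hT : 0 < T) (hφ : 0 ≤ φ)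
    (h : ℝ → ℝ) (hh : IntegrableOn h (Set.Icc 0 T))
    (G : ℝ → ℝ)
    (hGnonneg : ∀ t, 0 ≤ t → 0 ≤ G t)
    (hGcont : ContinuousOn G (Set.Ici 0))
    (hGbdd : ∃ M : ℝ, ∀ t, 0 ≤ t → G t ≤ M)
    (hGspd : ∀ ν : SignedMeasure ℝ,
      (∀ s : Set ℝ, s ∩ Set.Icc 0 T = ∅ → ν s = 0) → ν ≠ 0 →
      0 < sint ν (fun t => sint ν (fun s => G |t - s|)))
    (C : SignedMeasure ℝ → ℝ)
    (hC : ∀ μ : SignedMeasure ℝ, C μ =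
      sint μ (fun t => ∫ s in (0:ℝ)..t, h s)
        + (1/2) * sint μ (fun t => sint μ (fun s => G |t - s|))
        + φ * ∫ t in (0:ℝ)..T, (x + μ (Set.Ico 0 t))^2)
    (μstar : SignedMeasure ℝ) (hμstar : μstar ∈ Xi T x)
    (lam : ℝ)
    (hopt : ∀ t ∈ Set.Icc (0:ℝ) T,
      (∫ s in (0:ℝ)..t, h s)
        + sint μstar (fun s => G |t - s|)
        - 2 * φ * ∫ s in (0:ℝ)..t, (x + μstar (Set.Ico 0 s)) = lam) :
    ∀ μ ∈ Xi T x, C μstar ≤ C μ := by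
  intro μ hμ
  set ν : SignedMeasure ℝ := μ - μstar with hνdef
  have hμeq : μ = μstar + ν := by simp [hνdef]
  have hνs : ∀ s : Set ℝ, s ∩ Set.Icc 0 T = ∅ → ν s = 0 := fun s hs => by
    simp [hνdef, hμ.1 s hs, hμstar.1 s hs]
  have hν0 : ν Set.univ = 0 := by
    simp [hνdef, hμ.2, hμstar.2]
  have hGB : BM (fun p : ℝ × ℝ => G |p.1 - p.2|) := by
    obtain ⟨M, hM⟩ := hGbdd
    refine ⟨(hGcont.comp_continuous (by fun_prop) fun p => Set.mem_Ici.2 (abs_nonneg _)).measurable, M, fun p => ?_⟩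
    rw [abs_of_nonneg (hGnonneg _ (abs_nonneg _))]
    exact hM _ (abs_nonneg _)
  have hGs : ∀ t, BM (fun s => G |t - s|) := fun t =>
    hGB.comp (g := fun s => (t, s)) (by fun_prop)
  set X : ℝ → ℝ := fun t => x + μstar (Set.Ico 0 t) with hXdef
  set N : ℝ → ℝ := fun t => ν (Set.Ico 0 t) with hNdef
  have hX : BM X := (BM.const x).add (bm_apply μstar)
  have hN : BM N := bm_apply ν
  have hH := bm_clamp hT hh
  have hP := bm_clamp hT (f := X) (hX.integrable _)
  have hK := hGB.sint μstar
  have hL := hGB.sint ν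
  have hHc : ∀ m ∈ Xi T x, sint m (fun t => ∫ s in (0:ℝ)..t, h s)
      = sint m (fun t => ∫ s in (0:ℝ)..(max 0 (min t T)), h s) := fun m hm =>
    sint_congr hm.1 fun t ht => by rw [clamp_eq ht]
  -- quadratic form
  have hQ : sint μ (fun t => sint μ (fun s => G |t - s|))
      = sint μstar (fun t => sint μstar (fun s => G |t - s|))
        + 2 * sint ν (fun t => sint μstar (fun s => G |t - s|))
        + sint ν (fun t => sint ν (fun s => G |t - s|)) := by
    have hin : (fun t => sint μ (fun s => G |t - s|)) =
        fun t => sint μstar (fun s => G |t - s|) + sint ν (fun s => G |t - s|) := by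
      funext t
      rw [hμeq, sint_add _ _ (hGs t)]
    have hsw : sint μstar (fun t => sint ν (fun s => G |t - s|))
        = sint ν (fun t => sint μstar (fun s => G |t - s|)) := by
      have := sint_sint_swap hGB ν μstar
      simp only at this
      rw [this]
      simp only [abs_sub_comm]
    rw [hin, sint_add_fun μ hK hL, hμeq, sint_add _ _ hK, sint_add _ _ hL, hsw]
    ring
  -- risk term
  have hII : ∀ {f : ℝ → ℝ}, BM f → IntervalIntegrable f volume 0 T := fun hf =>
    ⟨hf.integrable _, hf.integrable _⟩
  have hR : ∫ t in (0:ℝ)..T, (x + μ (Set.Ico 0 t))^2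
      = (∫ t in (0:ℝ)..T, (X t)^2) + 2 * (∫ t in (0:ℝ)..T, X t * N t)
        + ∫ t in (0:ℝ)..T, N t * N t := by
    have : ∀ t, (x + μ (Set.Ico 0 t))^2 = X t * X t + 2 * (X t * N t) + N t * N t := fun t => by
      have : μ (Set.Ico 0 t) = μstar (Set.Ico 0 t) + N t := by simp [hNdef, hνdef]
      rw [this]
      simp only [hXdef]
      ring
    simp only [this, pow_two]
    have b1 := hX.mul hX
    have b2 := (BM.const (α := ℝ) 2).mul (hX.mul hN)
    rw [intervalIntegral.integral_add (hII (b1.add b2)) (hII (hN.mul hN)),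
      intervalIntegral.integral_add (hII b1) (hII b2), intervalIntegral.integral_const_mul]
  have hNN : 0 ≤ ∫ t in (0:ℝ)..T, N t * N t :=
    intervalIntegral.integral_nonneg hT.le fun t _ => mul_self_nonneg _
  have hF := inventory_fubini hT hX hνs hν0
  have hopt' : sint ν (fun t => ((∫ s in (0:ℝ)..(max 0 (min t T)), h s)
        + sint μstar (fun s => G |t - s|))
        + (-(2 * φ)) * ∫ s in (0:ℝ)..(max 0 (min t T)), X s) = 0 := by
    rw [sint_congr hνs (g := fun _ => lam), sint_const, hν0, mul_zero]
    intro t ht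
    have := hopt t ht
    rw [clamp_eq ht]
    linarith
  rw [sint_add_fun ν (hH.add hK) ((BM.const _).mul hP), sint_add_fun ν hH hK, sint_mul_fun] at hopt'
  have hspd : 0 ≤ sint ν (fun t => sint ν (fun s => G |t - s|)) := by
    by_cases h0 : ν = 0
    · rw [h0]
      simp [sint, SignedMeasure.toJordanDecomposition_zero]
    · exact (hGspd ν hνs h0).le
  have hHadd : sint μ (fun t => ∫ s in (0:ℝ)..(max 0 (min t T)), h s)
      = sint μstar (fun t => ∫ s in (0:ℝ)..(max 0 (min t T)), h s)
      + sint ν (fun t => ∫ s in (0:ℝ)..(max 0 (min t T)), h s) := by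
    rw [hμeq, sint_add _ _ hH]
  rw [hC, hC, hHc μ hμ, hHc μstar hμstar, hQ, hR, hHadd, hF]
  have hfin := mul_nonneg hφ hNN
  simp only [hXdef] at *
  nlinarith
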